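/- Let A ∈ ℝ^{m×N}, Y ∈ ℝ^{m×L}, λ > 0, and let C ∈ ℝ^{NL×NL} be symmetric with nonnegative entries. Consider F(Z) = ‖AZ − Y‖_F² + λ R_C(Z) on the nonnegative orthant K = ℝ₊^{N×L} = {Z : Z_{j,l} ≥ 0 for all j,l}. Then: (i) F is bounded from below on K; (ii) if {Z ∈ K : R_C(Z) = 0} ∩ {Z : AZ = 0} = {0}, then F is coercive on K, i.e., F(Z_n) → ∞ for every sequence (Z_n) in K with ‖Z_n‖_F → ∞; consequently F attains a minimizer on K, and there exists R > 0 such that every minimizer of F on K satisfies ‖Z‖_F ≤ R. -/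

import Mathlib

open Matrix BigOperators Filter

/-- The regularizer `R_C(Z) = vec(Z)ᵀ C vec(Z)`. -/
noncomputable def regC {N L : ℕ} (C : Matrix (Fin N × Fin L) (Fin N × Fin L) ℝ)
    (Z : Matrix (Fin N) (Fin L) ℝ) : ℝ :=
  ∑ p, ∑ q, Z p.1 p.2 * C p q * Z q.1 q.2

/-- Frobenius norm. -/
noncomputable def froNorm {m L : ℕ} (M : Matrix (Fin m) (Fin L) ℝ) : ℝ :=
  Real.sqrt (∑ i, ∑ j, (M i j) ^ 2)

theorem froNorm_sq {m L : ℕ} (M : Matrix (Fin m) (Fin L) ℝ) :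
    froNorm M ^ 2 = ∑ i, ∑ j, (M i j) ^ 2 :=
  Real.sq_sqrt (Finset.sum_nonneg fun _ _ => Finset.sum_nonneg fun _ _ => sq_nonneg _)

theorem froNorm_nonneg {m L : ℕ} (M : Matrix (Fin m) (Fin L) ℝ) : 0 ≤ froNorm M :=
  Real.sqrt_nonneg _

theorem sq_apply_le_froNorm_sq {m L : ℕ} (M : Matrix (Fin m) (Fin L) ℝ) (i : Fin m) (j : Fin L) :
    M i j ^ 2 ≤ froNorm M ^ 2 := by
  rw [froNorm_sq]
  calc M i j ^ 2 ≤ ∑ j, M i j ^ 2 :=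
        Finset.single_le_sum (f := fun j => M i j ^ 2) (fun _ _ => sq_nonneg _) (Finset.mem_univ j)
    _ ≤ _ := Finset.single_le_sum (f := fun i => ∑ j, M i j ^ 2)
        (fun _ _ => Finset.sum_nonneg fun _ _ => sq_nonneg _) (Finset.mem_univ i)

theorem froNorm_eq_zero {m L : ℕ} {M : Matrix (Fin m) (Fin L) ℝ} (h : froNorm M = 0) : M = 0 := by
  ext i j
  have := sq_apply_le_froNorm_sq M i j
  rw [h] at this
  simpa using le_antisymm (by simpa using this) (sq_nonneg (M i j))

theorem froNorm_smul_sq {m L : ℕ} (t : ℝ) (M : Matrix (Fin m) (Fin L) ℝ) :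
    froNorm (t • M) ^ 2 = t ^ 2 * froNorm M ^ 2 := by
  simp only [froNorm_sq, Matrix.smul_apply, smul_eq_mul, mul_pow, Finset.mul_sum]

theorem froNorm_sq_le_two_mul_sub {m L : ℕ} (M Y : Matrix (Fin m) (Fin L) ℝ) :
    froNorm M ^ 2 ≤ 2 * froNorm (M - Y) ^ 2 + 2 * froNorm Y ^ 2 := by
  simp only [froNorm_sq, Finset.mul_sum, ← Finset.sum_add_distrib, Matrix.sub_apply]
  refine Finset.sum_le_sum fun i _ => Finset.sum_le_sum fun j _ => ?_
  nlinarith [sq_nonneg (M i j - 2 * Y i j)]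

theorem continuous_froNorm {m L : ℕ} :
    Continuous (froNorm : Matrix (Fin m) (Fin L) ℝ → ℝ) := by
  unfold froNorm
  fun_prop

theorem isCompact_froNorm_le {m L : ℕ} (r : ℝ) :
    IsCompact {M : Matrix (Fin m) (Fin L) ℝ | froNorm M ≤ r} := by
  have hbox : IsCompact (Set.univ.pi fun _ : Fin m => Set.univ.pi fun _ : Fin L =>
      Set.Icc (-r) r) :=
    isCompact_univ_pi fun _ => isCompact_univ_pi fun _ => isCompact_Icc
  refine hbox.of_isClosed_subset (isClosed_le continuous_froNorm continuous_const) ?_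
  intro M hM i _ j _
  have habs := abs_le.mp (abs_le_of_sq_le_sq (sq_apply_le_froNorm_sq M i j) (froNorm_nonneg M))
  have hM' : froNorm M ≤ r := hM
  exact ⟨by linarith [habs.1], by linarith [habs.2]⟩

theorem continuous_regC {N L : ℕ} (C : Matrix (Fin N × Fin L) (Fin N × Fin L) ℝ) :
    Continuous (regC C) := by
  unfold regC
  fun_prop

theorem regC_smul {N L : ℕ} (C : Matrix (Fin N × Fin L) (Fin N × Fin L) ℝ) (t : ℝ)
    (Z : Matrix (Fin N) (Fin L) ℝ) : regC C (t • Z) = t ^ 2 * regC C Z := by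
  simp only [regC, Matrix.smul_apply, smul_eq_mul, Finset.mul_sum]
  exact Finset.sum_congr rfl fun _ _ => Finset.sum_congr rfl fun _ _ => by ring

theorem regC_nonneg {N L : ℕ} {C : Matrix (Fin N × Fin L) (Fin N × Fin L) ℝ}
    (hC : ∀ p q, 0 ≤ C p q) {Z : Matrix (Fin N) (Fin L) ℝ} (hZ : ∀ j l, 0 ≤ Z j l) :
    0 ≤ regC C Z :=
  Finset.sum_nonneg fun _ _ => Finset.sum_nonneg fun _ _ =>
    mul_nonneg (mul_nonneg (hZ _ _) (hC _ _)) (hZ _ _)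

theorem isClosed_entrywise_nonneg {N L : ℕ} :
    IsClosed {Z : Matrix (Fin N) (Fin L) ℝ | ∀ j l, 0 ≤ Z j l} := by
  simp only [Set.ofPred_forall]
  exact isClosed_iInter fun j => isClosed_iInter fun l =>
    isClosed_le continuous_const (by fun_prop)

/-- A quadratic form that is positive on the nonzero entrywise nonnegative matrices dominates a
positive multiple of the squared Frobenius norm there. -/
theorem exists_pos_mul_froNorm_sq_le {N L : ℕ} {G : Matrix (Fin N) (Fin L) ℝ → ℝ}
    (hcont : Continuous G) (hhom : ∀ (t : ℝ) Z, G (t • Z) = t ^ 2 * G Z)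
    (hpos : ∀ Z, (∀ j l, 0 ≤ Z j l) → Z ≠ 0 → 0 < G Z) :
    ∃ c, 0 < c ∧ ∀ Z, (∀ j l, 0 ≤ Z j l) → c * froNorm Z ^ 2 ≤ G Z := by
  have hcomp : IsCompact ({Z : Matrix (Fin N) (Fin L) ℝ | froNorm Z ≤ 1} ∩
      ({Z | froNorm Z = 1} ∩ {Z | ∀ j l, 0 ≤ Z j l})) :=
    (isCompact_froNorm_le 1).inter_right
      ((isClosed_eq continuous_froNorm continuous_const).inter isClosed_entrywise_nonneg)
  obtain ⟨c, hc, hle⟩ : ∃ c, 0 < c ∧ ∀ Z : Matrix (Fin N) (Fin L) ℝ, froNorm Z = 1 →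
      (∀ j l, 0 ≤ Z j l) → c ≤ G Z := by
    rcases Set.eq_empty_or_nonempty ({Z : Matrix (Fin N) (Fin L) ℝ | froNorm Z ≤ 1} ∩
      ({Z | froNorm Z = 1} ∩ {Z | ∀ j l, 0 ≤ Z j l})) with he | hne
    · refine ⟨1, one_pos, fun Z h1 hZ => ?_⟩
      exact (Set.eq_empty_iff_forall_notMem.mp he Z ⟨le_of_eq h1, h1, hZ⟩).elim
    · obtain ⟨W, ⟨-, hW1, hW⟩, hmin⟩ := hcomp.exists_isMinOn hne hcont.continuousOn
      refine ⟨G W, hpos W hW ?_, fun Z h1 hZ => hmin ⟨le_of_eq h1, h1, hZ⟩⟩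
      rintro rfl
      simp [froNorm] at hW1
  refine ⟨c, hc, fun Z hZ => ?_⟩
  rcases (froNorm_nonneg Z).eq_or_lt with h0 | h0
  · have hG0 : G 0 = 0 := by simpa using hhom 0 0
    rw [froNorm_eq_zero h0.symm, hG0]
    simp [froNorm]
  · have hnorm : froNorm ((froNorm Z)⁻¹ • Z) = 1 := by
      rw [← sq_eq_sq₀ (froNorm_nonneg _) zero_le_one, froNorm_smul_sq]
      field_simp
    have key := hle _ hnorm fun j l => mul_nonneg (inv_nonneg.mpr h0.le) (hZ j l)
    rw [hhom, inv_pow, ← div_eq_inv_mul, le_div_iff₀ (by positivity)] at key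
    exact key

theorem bounded_below_coercive_minimizers {m N L : ℕ}
    (A : Matrix (Fin m) (Fin N) ℝ) (Y : Matrix (Fin m) (Fin L) ℝ)
    (lam : ℝ) (hlam : 0 < lam)
    (C : Matrix (Fin N × Fin L) (Fin N × Fin L) ℝ)
    (hsymm : C.IsSymm) (hnonneg : ∀ p q, 0 ≤ C p q)
    (F : Matrix (Fin N) (Fin L) ℝ → ℝ)
    (hF : ∀ Z, F Z = froNorm (A * Z - Y) ^ 2 + lam * regC C Z)
    (K : Set (Matrix (Fin N) (Fin L) ℝ))
    (hK : K = {Z | ∀ (j : Fin N) (l : Fin L), 0 ≤ Z j l}) :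
    (∃ b : ℝ, ∀ Z ∈ K, b ≤ F Z) ∧
    (( {Z ∈ K | regC C Z = 0} ∩ {Z | A * Z = 0} = {0} ) →
      ((∀ Zn : ℕ → Matrix (Fin N) (Fin L) ℝ, (∀ n, Zn n ∈ K) →
          Tendsto (fun n => froNorm (Zn n)) atTop atTop →
          Tendsto (fun n => F (Zn n)) atTop atTop) ∧
       (∃ Zmin ∈ K, ∀ Z ∈ K, F Zmin ≤ F Z) ∧
       (∃ R : ℝ, 0 < R ∧ ∀ Z ∈ K, (∀ W ∈ K, F Z ≤ F W) → froNorm Z ≤ R))) := by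
  have hK' : ∀ {Z}, Z ∈ K ↔ ∀ j l, 0 ≤ Z j l := by
    intro Z
    rw [hK]
    exact Iff.rfl
  have hreg : ∀ Z ∈ K, 0 ≤ lam * regC C Z := fun Z hZ =>
    mul_nonneg hlam.le (regC_nonneg hnonneg (hK'.mp hZ))
  refine ⟨⟨0, fun Z hZ => ?_⟩, fun hker => ?_⟩
  · rw [hF]
    exact add_nonneg (sq_nonneg _) (hreg Z hZ)
  have hFcont : Continuous F := by
    rw [funext hF]
    have h1 : Continuous fun Z : Matrix (Fin N) (Fin L) ℝ => froNorm (A * Z - Y) :=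
      continuous_froNorm.comp (by fun_prop)
    have h2 := continuous_regC C
    fun_prop
  obtain ⟨c, hc, hcle⟩ := exists_pos_mul_froNorm_sq_le
    (G := fun Z => froNorm (A * Z) ^ 2 + lam * regC C Z)
    (by
      have h1 : Continuous fun Z : Matrix (Fin N) (Fin L) ℝ => froNorm (A * Z) :=
        continuous_froNorm.comp (by fun_prop)
      have h2 := continuous_regC C
      fun_prop)
    (fun t Z => by
      simp only [Matrix.mul_smul, froNorm_smul_sq, regC_smul]
      ring)
    (fun Z hZ hZ0 => by
      have hregZ := hreg Z (hK'.mpr hZ)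
      refine lt_of_le_of_ne (add_nonneg (sq_nonneg _) hregZ) fun h => hZ0 ?_
      have hA : froNorm (A * Z) = 0 :=
        pow_eq_zero_iff two_ne_zero |>.mp (by linarith [sq_nonneg (froNorm (A * Z))])
      have hR : lam * regC C Z = 0 := by linarith [sq_nonneg (froNorm (A * Z))]
      have hmem : Z ∈ {Z ∈ K | regC C Z = 0} ∩ {Z | A * Z = 0} :=
        ⟨⟨hK'.mpr hZ, (mul_eq_zero.mp hR).resolve_left hlam.ne'⟩, froNorm_eq_zero hA⟩
      rw [hker] at hmem
      exact hmem)
  have hlow : ∀ Z ∈ K, c / 2 * froNorm Z ^ 2 - froNorm Y ^ 2 ≤ F Z := fun Z hZ => by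
    have h1 := hcle Z (hK'.mp hZ)
    have h2 := froNorm_sq_le_two_mul_sub (A * Z) Y
    have h3 := hreg Z hZ
    rw [hF]
    linarith
  have h0K : (0 : Matrix (Fin N) (Fin L) ℝ) ∈ K := hK'.mpr fun _ _ => le_rfl
  set r : ℝ := (F 0 + froNorm Y ^ 2) / (c / 2) + 1 with hr
  have hsub : ∀ Z ∈ K, F Z ≤ F 0 → froNorm Z ≤ r := fun Z hZ hle => by
    have h1 : froNorm Z ^ 2 ≤ (F 0 + froNorm Y ^ 2) / (c / 2) := by
      rw [le_div_iff₀ (by positivity)]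
      linarith [hlow Z hZ]
    nlinarith [sq_nonneg (froNorm Z - 1), sq_nonneg (froNorm Z)]
  have hr0 : 0 < r := by
    have hF0 : 0 ≤ F 0 := by
      rw [hF]
      exact add_nonneg (sq_nonneg _) (hreg 0 h0K)
    positivity
  refine ⟨fun Zn hZn hlim => ?_, ?_, r, hr0, fun Z hZ hmin => hsub Z hZ (hmin 0 h0K)⟩
  · refine tendsto_atTop_mono (fun n => hlow _ (hZn n)) ?_
    exact tendsto_atTop_add_const_right _ _
      (((tendsto_pow_atTop two_ne_zero).comp hlim).const_mul_atTop (half_pos hc))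
  · have hcomp : IsCompact ({Z | froNorm Z ≤ r} ∩ K) := by
      rw [hK]
      exact (isCompact_froNorm_le r).inter_right isClosed_entrywise_nonneg
    have h0r := hsub 0 h0K le_rfl
    obtain ⟨W, ⟨-, hWK⟩, hW⟩ := hcomp.exists_isMinOn ⟨0, h0r, h0K⟩ hFcont.continuousOn
    refine ⟨W, hWK, fun Z hZ => ?_⟩
    rcases le_total (F Z) (F 0) with h | h
    · exact hW ⟨hsub Z hZ h, hZ⟩
    · exact (hW (show (0 : Matrix (Fin N) (Fin L) ℝ) ∈ _ from ⟨h0r, h0K⟩)).trans h
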